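/- arXiv:2207.13961 — 2 statements merged into one kernel-verified Lean document; each statement's English description precedes it below -/
import Mathlib

section
/- Let T̂ ≥ 1 be a real number and let R(T̂) be the subset of ℂ consisting of all z = x + iy with |x| ≤ 1/2 and 0 < y ≤ T̂, with the open disc of radius 1/(2c²T̂) centered at a/c + i/(2c²T̂) removed for every integer c ≥ 1 and every integer a coprime to c. Then for every real s > 1, the integral of (Im z)^{s−2} over R(T̂) with respect to planar Lebesgue measure equals T̂^{s−1}/(s−1) − (ζ*(2s−1)/ζ*(2s))·T̂^{−s}/s. -/
open Filter Real Topology MeasureTheory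

/-- The truncated region `𝓗^T̂ ∩ {|Re z| ≤ 1/2}`: the part of the vertical strip of the
upper half plane below height `T̂`, with the disc of radius `1/(2c²T̂)` tangent to the real
axis at `a/c` removed for every `c ≥ 1` and every `a` coprime to `c`. -/
def truncatedRegion (That : ℝ) : Set ℂ :=
  {z : ℂ | |z.re| ≤ 1 / 2 ∧ 0 < z.im ∧ z.im ≤ That} \
    ⋃ (c : ℤ) (_ : 1 ≤ c) (a : ℤ) (_ : IsCoprime a c),
      Metric.ball (((a : ℝ) / (c : ℝ) : ℝ) + ((1 / (2 * (c : ℝ) ^ 2 * That) : ℝ) : ℂ) * Complex.I)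
        (1 / (2 * (c : ℝ) ^ 2 * That))

namespace ZagierAux

lemma totient_LSeries (u : ℝ) (hu : 2 < u) :
    LSeriesSummable (fun n => (Nat.totient n : ℂ)) u ∧
    LSeries (fun n => (Nat.totient n : ℂ)) u * riemannZeta u = riemannZeta (u - 1) := by
  have h1 : LSeriesSummable (fun n => (Nat.totient n : ℂ)) u := by
    refine LSeriesSummable_of_le_const_mul_rpow (x := 2) (by simpa using hu) ⟨1, fun n hn => ?_⟩
    have : (2 : ℝ) - 1 = 1 := by norm_num
    rw [this, Real.rpow_one, one_mul]
    simp only [Complex.norm_natCast]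
    exact_mod_cast Nat.totient_le n
  refine ⟨h1, ?_⟩
  have hu1 : 1 < (u : ℂ).re := by simp; linarith
  rw [← LSeries_one_eq_riemannZeta hu1, ← LSeries_convolution' h1 (LSeriesSummable_one_iff.mpr hu1),
    zeta_eq_tsum_one_div_nat_cpow (by simp; linarith), LSeries]
  congr 1
  ext n
  rcases eq_or_ne n 0 with rfl | hn
  · rw [LSeries.term_zero, Nat.cast_zero, Complex.zero_cpow, div_zero]
    rw [← Complex.ofReal_one, ← Complex.ofReal_sub]
    exact_mod_cast (by linarith : u - 1 ≠ 0)
  · rw [LSeries.term_of_ne_zero hn, LSeries.convolution_def]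
    have : ∑ p ∈ n.divisorsAntidiagonal, (Nat.totient p.1 : ℂ) * (1 : ℕ → ℂ) p.2 = n := by
      simp only [Pi.one_apply, mul_one]
      rw [Nat.sum_divisorsAntidiagonal (fun i _ => (Nat.totient i : ℂ))]
      exact_mod_cast Nat.sum_totient n
    simp only [this]
    have hn' : (n : ℂ) ≠ 0 := by exact_mod_cast hn
    rw [Complex.cpow_sub _ _ hn', Complex.cpow_one, one_div_div]

/-- weighted measure -/
noncomputable def nu (s : ℝ) : Measure ℂ :=
  volume.withDensity (fun z => ENNReal.ofReal (z.im ^ (s - 2)))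

lemma nu_slice (s : ℝ) {A : Set ℂ} (hA : MeasurableSet A) :
    nu s A = ∫⁻ y : ℝ, ENNReal.ofReal (y ^ (s - 2)) * volume {x : ℝ | (⟨x, y⟩ : ℂ) ∈ A} := by
  have hm : Measurable (fun z : ℂ => ENNReal.ofReal (z.im ^ (s - 2))) := by fun_prop
  have hmk : Measurable (fun p : ℝ × ℝ => (⟨p.1, p.2⟩ : ℂ)) :=
    Complex.measurableEquivRealProd.symm.measurable
  rw [nu, withDensity_apply _ hA, ← lintegral_indicator hA,
    ← (Complex.volume_preserving_equiv_real_prod.symm).lintegral_comp_emb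
      Complex.measurableEquivRealProd.symm.measurableEmbedding, Measure.volume_eq_prod,
    lintegral_prod_symm]
  swap
  · exact ((hm.indicator hA).comp Complex.measurableEquivRealProd.symm.measurable).aemeasurable
  congr 1
  ext y
  have hs : MeasurableSet {x : ℝ | (⟨x, y⟩ : ℂ) ∈ A} :=
    (hmk.comp (measurable_id.prodMk measurable_const)) hA
  rw [← lintegral_indicator_one hs, ← lintegral_const_mul _ (measurable_one.indicator hs)]
  congr 1
  ext x
  by_cases hx : (⟨x, y⟩ : ℂ) ∈ A
  · have h1 : Complex.measurableEquivRealProd.symm (x, y) ∈ A := hx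
    have h2 : x ∈ {x : ℝ | (⟨x, y⟩ : ℂ) ∈ A} := hx
    rw [Set.indicator_of_mem h1, Set.indicator_of_mem h2]
    simp
  · have h1 : Complex.measurableEquivRealProd.symm (x, y) ∉ A := hx
    have h2 : x ∉ {x : ℝ | (⟨x, y⟩ : ℂ) ∈ A} := hx
    rw [Set.indicator_of_notMem h1, Set.indicator_of_notMem h2]
    simp

lemma nu_translate (s q : ℝ) {A : Set ℂ} (hA : MeasurableSet A) :
    nu s ((fun z : ℂ => z + (q : ℂ)) ⁻¹' A) = nu s A := by
  rw [nu_slice s hA, nu_slice s (hA.preimage (by fun_prop))]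
  congr 1
  ext y
  congr 1
  rw [← measure_preimage_add_right volume q {x : ℝ | (⟨x, y⟩ : ℂ) ∈ A}]
  congr 1
  ext x
  simp only [Set.mem_preimage, Set.mem_ofPred_eq]
  have : (⟨x, y⟩ : ℂ) + (q : ℂ) = ⟨x + q, y⟩ := by
    apply Complex.ext <;> simp
  rw [this]

lemma nu_strip (s T : ℝ) (hs : 1 < s) (hT : 1 ≤ T) {I : Set ℝ} (hI : MeasurableSet I)
    (hv : volume I = 1) :
    nu s {z : ℂ | z.re ∈ I ∧ 0 < z.im ∧ z.im ≤ T} = ENNReal.ofReal (T ^ (s - 1) / (s - 1)) := by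
  have hA : MeasurableSet {z : ℂ | z.re ∈ I ∧ 0 < z.im ∧ z.im ≤ T} := by
    refine (hI.preimage Complex.measurable_re).inter
      ((measurableSet_Ioc (a := (0:ℝ)) (b := T)).preimage Complex.measurable_im)
  rw [nu_slice s hA]
  have : ∀ y : ℝ, ENNReal.ofReal (y ^ (s - 2)) *
      volume {x : ℝ | (⟨x, y⟩ : ℂ) ∈ {z : ℂ | z.re ∈ I ∧ 0 < z.im ∧ z.im ≤ T}} =
      (Set.Ioc 0 T).indicator (fun y => ENNReal.ofReal (y ^ (s - 2))) y := by
    intro y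
    by_cases hy : y ∈ Set.Ioc 0 T
    · rw [Set.indicator_of_mem hy]
      have h : {x : ℝ | (⟨x, y⟩ : ℂ) ∈ {z : ℂ | z.re ∈ I ∧ 0 < z.im ∧ z.im ≤ T}} = I := by
        ext x; simp [hy.1, hy.2]
      rw [h, hv, mul_one]
    · rw [Set.indicator_of_notMem hy]
      have h : {x : ℝ | (⟨x, y⟩ : ℂ) ∈ {z : ℂ | z.re ∈ I ∧ 0 < z.im ∧ z.im ≤ T}} = ∅ := by
        ext x
        simp only [Set.mem_ofPred_eq, Set.mem_empty_iff_false, iff_false]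
        exact fun h => hy h.2
      rw [h]; simp
  simp_rw [this]
  have hint : IntervalIntegrable (fun y : ℝ => y ^ (s - 2)) volume 0 T :=
    intervalIntegral.intervalIntegrable_rpow' (by linarith)
  rw [lintegral_indicator measurableSet_Ioc, ← ofReal_integral_eq_lintegral_ofReal]
  · rw [← intervalIntegral.integral_of_le (by linarith), integral_rpow (Or.inl (by linarith)),
      show s - 2 + 1 = s - 1 by ring, Real.zero_rpow (by linarith), sub_zero]
  · exact (intervalIntegrable_iff_integrableOn_Ioc_of_le (by linarith)).mp hint
  · filter_upwards [ae_restrict_mem measurableSet_Ioc] with y hy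
    exact Real.rpow_nonneg hy.1.le _

lemma nu_ball (s : ℝ) (hs : 1 < s) (x₀ r : ℝ) (hr : 0 < r) :
    nu s (Metric.ball (⟨x₀, r⟩ : ℂ) r) =
      ENNReal.ofReal (2 * ProbabilityTheory.beta (s - 1 / 2) (3 / 2) * (2 * r) ^ s) := by
  have hb : 0 < ProbabilityTheory.beta (s - 1 / 2) (3 / 2) :=
    ProbabilityTheory.beta_pos (by linarith) (by norm_num)
  rw [nu_slice s Metric.isOpen_ball.measurableSet]
  have hslice : ∀ y : ℝ, volume {x : ℝ | (⟨x, y⟩ : ℂ) ∈ Metric.ball (⟨x₀, r⟩ : ℂ) r} =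
      ENNReal.ofReal (2 * √(2 * r * y - y ^ 2)) := by
    intro y
    rw [← Real.volume_ball x₀]
    congr 1
    ext x
    simp only [Set.mem_ofPred_eq, Metric.mem_ball, Complex.dist_eq, Real.dist_eq]
    rw [Real.lt_sqrt (abs_nonneg _), sq_abs, Complex.norm_def, Real.sqrt_lt' hr,
      Complex.normSq_apply]
    simp only [Complex.sub_re, Complex.sub_im]
    constructor <;> intro h <;> nlinarith
  simp_rw [hslice]
  set d := 2 * r with hd
  have hd0 : 0 < d := by positivity
  conv_lhs => rw [← Real.smul_map_volume_mul_left hd0.ne']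
  rw [lintegral_smul_measure, lintegral_map (by fun_prop) (by fun_prop)]
  have hpt : ∀ t : ℝ, ENNReal.ofReal ((d * t) ^ (s - 2)) *
      ENNReal.ofReal (2 * √(d * (d * t) - (d * t) ^ 2)) =
      ENNReal.ofReal (2 * ProbabilityTheory.beta (s - 1 / 2) (3 / 2) * d ^ (s - 1)) *
        ProbabilityTheory.betaPDF (s - 1 / 2) (3 / 2) t := by
    intro t
    rw [ProbabilityTheory.betaPDF_eq]
    split_ifs with ht
    · rw [← ENNReal.ofReal_mul (by have := ht.1; positivity), ← ENNReal.ofReal_mul (by positivity)]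
      congr 1
      have h1 : 0 < t := ht.1
      have h2 : 0 < 1 - t := by linarith [ht.2]
      have e1 : d * (d * t) - (d * t) ^ 2 = d ^ 2 * (t * (1 - t)) := by ring
      rw [e1, Real.sqrt_mul (by positivity), Real.sqrt_sq hd0.le, Real.sqrt_mul h1.le,
        Real.sqrt_eq_rpow, Real.sqrt_eq_rpow, Real.mul_rpow hd0.le h1.le,
        show s - 1 / 2 - 1 = (s - 2) + 1 / 2 by ring, Real.rpow_add h1,
        show (3 / 2 - 1 : ℝ) = 1 / 2 by norm_num, show s - 1 = (s - 2) + 1 by ring,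
        Real.rpow_add hd0, Real.rpow_one]
      generalize ProbabilityTheory.beta (s - 1 / 2) (3 / 2) = b at hb
      field_simp
    · have : √(d * (d * t) - (d * t) ^ 2) = 0 := by
        apply Real.sqrt_eq_zero_of_nonpos
        have : t * (1 - t) ≤ 0 := by
          by_contra! h
          apply ht
          constructor <;> nlinarith
        nlinarith [sq_nonneg d]
      rw [this]; simp
  simp_rw [hpt]
  rw [lintegral_const_mul _ (by unfold ProbabilityTheory.betaPDF; fun_prop),
    ProbabilityTheory.lintegral_betaPDF_eq_one (by linarith) (by norm_num), mul_one, smul_eq_mul,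
    ← ENNReal.ofReal_mul (by positivity), abs_of_pos hd0, show s = (s - 1) + 1 by ring,
    Real.rpow_add hd0, Real.rpow_one]
  congr 1
  ring_nf

/-- radius -/
noncomputable def rad (T : ℝ) (c : ℕ) : ℝ := 1 / (2 * (c : ℝ) ^ 2 * T)

/-- the disc attached to `a/c`, empty unless `a` and `c` are coprime -/
def Bd (T : ℝ) (c : ℕ) (a : ℤ) : Set ℂ :=
  {z | IsCoprime a (c : ℤ) ∧ z ∈ Metric.ball (⟨(a : ℝ) / (c : ℝ), rad T c⟩ : ℂ) (rad T c)}

/-- half-open strip -/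
def St (T : ℝ) : Set ℂ := {z : ℂ | z.re ∈ Set.Ioc (-1 / 2 : ℝ) (1 / 2) ∧ 0 < z.im ∧ z.im ≤ T}

lemma measurableSet_St (T : ℝ) : MeasurableSet (St T) :=
  (measurableSet_Ioc.preimage Complex.measurable_re).inter
      ((measurableSet_Ioc (a := (0:ℝ)) (b := T)).preimage Complex.measurable_im)

lemma measurableSet_Bd (T : ℝ) (c : ℕ) (a : ℤ) : MeasurableSet (Bd T c a) :=
  (MeasurableSet.const _).inter Metric.isOpen_ball.measurableSet

lemma mem_Bd {T : ℝ} (hT : 1 ≤ T) {c : ℕ} {a : ℤ} {z : ℂ} :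
    z ∈ Bd T c a ↔ IsCoprime a (c : ℤ) ∧ 0 < c ∧
      (z.re - a / c) ^ 2 + z.im ^ 2 < 2 * rad T c * z.im := by
  unfold Bd
  simp only [Set.mem_ofPred_eq, Metric.mem_ball, Complex.dist_eq]
  refine and_congr_right fun _ => ?_
  rcases Nat.eq_zero_or_pos c with rfl | hc
  · simp [rad]
  · have hc' : (0 : ℝ) < c := by exact_mod_cast hc
    have hr : 0 < rad T c := by unfold rad; positivity
    rw [Complex.norm_def, Real.sqrt_lt' hr, Complex.normSq_apply]
    simp only [Complex.sub_re, Complex.sub_im, hc, true_and]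
    constructor <;> intro h <;> nlinarith

lemma Bd_im {T : ℝ} (hT : 1 ≤ T) {c : ℕ} {a : ℤ} {z : ℂ} (hz : z ∈ Bd T c a) :
    0 < z.im ∧ z.im ≤ T := by
  obtain ⟨-, hc, h⟩ := (mem_Bd hT).1 hz
  have hc' : (1 : ℝ) ≤ c := by exact_mod_cast hc
  have hr : 0 < rad T c := by unfold rad; positivity
  have hr2 : 2 * rad T c ≤ 1 := by
    have : 2 * rad T c = 1 / ((c : ℝ) ^ 2 * T) := by unfold rad; field_simp
    rw [this, div_le_one (by positivity)]
    nlinarith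
  have h0 : 0 < z.im := by
    by_contra! h'
    nlinarith [sq_nonneg (z.re - a / c), sq_nonneg z.im]
  refine ⟨h0, ?_⟩
  nlinarith [sq_nonneg (z.re - a / c)]

lemma Bd_eq {T : ℝ} (hT : 1 ≤ T) {c c' : ℕ} {a a' : ℤ} {z : ℂ} (hz : z ∈ Bd T c a)
    (hz' : z ∈ Bd T c' a') : c = c' ∧ a = a' := by
  have him := (Bd_im hT hz).1
  obtain ⟨h1, hc, h⟩ := (mem_Bd hT).1 hz
  obtain ⟨h1', hc', h'⟩ := (mem_Bd hT).1 hz'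
  have hcr : (1 : ℝ) ≤ c := by exact_mod_cast hc
  have hcr' : (1 : ℝ) ≤ c' := by exact_mod_cast hc'
  have hr : 0 < rad T c := by unfold rad; positivity
  have hr' : 0 < rad T c' := by unfold rad; positivity
  have key : ((a : ℝ) / c - a' / c') ^ 2 < 4 * rad T c * rad T c' := by
    generalize rad T c = r at *
    generalize rad T c' = r' at *
    set u := z.re - a / c
    set v := z.re - a' / c'
    have huv : (a : ℝ) / c - a' / c' = v - u := by simp only [u, v]; ring
    rw [huv]
    have n1 : dist (⟨u, z.im - r⟩ : ℂ) 0 < r := by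
      rw [Complex.dist_eq, Complex.norm_def, Real.sqrt_lt' hr, Complex.normSq_apply]
      simp; nlinarith
    have n2 : dist (⟨v, z.im - r'⟩ : ℂ) 0 < r' := by
      rw [Complex.dist_eq, Complex.norm_def, Real.sqrt_lt' hr', Complex.normSq_apply]
      simp; nlinarith
    have n3 := (dist_triangle_right (⟨u, z.im - r⟩ : ℂ) ⟨v, z.im - r'⟩ 0).trans_lt
      (add_lt_add n1 n2)
    rw [Complex.dist_eq, Complex.norm_def, Real.sqrt_lt' (by positivity),
      Complex.normSq_apply] at n3
    simp at n3
    nlinarith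
  have key2 : ((a : ℝ) * c' - a' * c) ^ 2 < 1 := by
    have e1 : ((a : ℝ) / c - a' / c') ^ 2 = ((a : ℝ) * c' - a' * c) ^ 2 / (c * c' : ℝ) ^ 2 := by
      field_simp
    have e2 : 4 * rad T c * rad T c' = (1 / T ^ 2) / (c * c' : ℝ) ^ 2 := by
      unfold rad; field_simp; norm_num
    rw [e1, e2, div_lt_div_iff_of_pos_right (by positivity)] at key
    refine key.trans_le ?_
    rw [div_le_one (by positivity)]
    nlinarith
  have key3 : (a * c' - a' * c) ^ 2 < 1 := by exact_mod_cast key2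
  have key4 : a * c' = a' * c := by nlinarith
  have d1 : (c : ℤ) ∣ c' := h1.symm.dvd_of_dvd_mul_left (Dvd.intro_left a' key4.symm)
  have d2 : (c' : ℤ) ∣ c := h1'.symm.dvd_of_dvd_mul_left (Dvd.intro_left a key4)
  have hcc : c = c' := Nat.dvd_antisymm (by exact_mod_cast d1) (by exact_mod_cast d2)
  subst hcc
  refine ⟨rfl, ?_⟩
  have : (c : ℤ) ≠ 0 := by exact_mod_cast hc.ne'
  exact mul_right_cancel₀ this key4

lemma mem_Bd_shift {T : ℝ} (hT : 1 ≤ T) {c : ℕ} (i q : ℤ) (z : ℂ) :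
    z + ((q : ℝ) : ℂ) ∈ Bd T c (q * c + i) ↔ z ∈ Bd T c i := by
  rw [mem_Bd hT, mem_Bd hT]
  have : IsCoprime (q * (c : ℤ) + i) c ↔ IsCoprime i (c : ℤ) := by
    rw [add_comm]; exact IsCoprime.add_mul_right_left_iff
  rw [this]
  refine and_congr_right fun _ => and_congr_right fun hc => ?_
  have hc' : (c : ℝ) ≠ 0 := by exact_mod_cast hc.ne'
  have e : (z.re + q - ((q * c + i : ℤ) : ℝ) / c) = z.re - i / c := by
    push_cast; field_simp; ring
  simp [-Int.cast_add, -Int.cast_mul, e]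

lemma nu_Bd {T : ℝ} (hT : 1 ≤ T) (s : ℝ) (hs : 1 < s) {c : ℕ} (hc : 0 < c) (i : ℤ) :
    nu s (Bd T c i) = if IsCoprime i (c : ℤ) then
      ENNReal.ofReal (2 * ProbabilityTheory.beta (s - 1 / 2) (3 / 2) * (2 * rad T c) ^ s) else 0 := by
  have hc' : (0 : ℝ) < c := by exact_mod_cast hc
  have hr : 0 < rad T c := by unfold rad; positivity
  split_ifs with h
  · rw [← nu_ball s hs (i / c) _ hr]
    congr 1
    ext z
    simp [Bd, h]
  · simp [Bd, h]

lemma tsum_shift {T : ℝ} (hT : 1 ≤ T) (s : ℝ) (c : ℕ) (i : ℤ) :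
    ∑' q : ℤ, nu s (St T ∩ Bd T c (q * c + i)) = nu s (Bd T c i) := by
  have h1 : ∀ q : ℤ, nu s (St T ∩ Bd T c (q * c + i)) =
      nu s ((fun z : ℂ => z + ((q : ℝ) : ℂ)) ⁻¹' St T ∩ Bd T c i) := by
    intro q
    rw [← nu_translate s q ((measurableSet_St T).inter (measurableSet_Bd _ _ _))]
    congr 1
    ext z
    simp only [Set.mem_preimage, Set.mem_inter_iff, mem_Bd_shift hT]
  simp_rw [h1]
  rw [← measure_iUnion]
  · congr 1
    ext z
    simp only [Set.mem_iUnion, Set.mem_inter_iff, Set.mem_preimage]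
    constructor
    · rintro ⟨q, -, h⟩; exact h
    · intro h
      obtain ⟨q, hq, -⟩ := existsUnique_add_zsmul_mem_Ioc (zero_lt_one' ℝ) z.re (-1 / 2)
      refine ⟨q, ?_, h⟩
      obtain ⟨h3, h4⟩ := Bd_im hT h
      refine ⟨?_, by simpa using h3, by simpa using h4⟩
      norm_num at hq ⊢
      exact hq
  · intro q q' hqq
    refine Set.disjoint_left.2 fun z hz hz' => hqq ?_
    obtain ⟨⟨⟨h1, h2⟩, -⟩, -⟩ := hz
    obtain ⟨⟨⟨h3, h4⟩, -⟩, -⟩ := hz'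
    simp at h1 h2 h3 h4
    have a1 : (q : ℝ) - q' < 1 := by linarith
    have a2 : (q' : ℝ) - q < 1 := by linarith
    have b1 : q - q' < 1 := by exact_mod_cast a1
    have b2 : q' - q < 1 := by exact_mod_cast a2
    omega
  · intro q
    exact ((measurableSet_St T).preimage (by fun_prop)).inter (measurableSet_Bd _ _ _)

lemma tsum_Bd {T : ℝ} (hT : 1 ≤ T) (s : ℝ) (hs : 1 < s) (c : ℕ) :
    ∑' a : ℤ, nu s (St T ∩ Bd T c a) = Nat.totient c *
      ENNReal.ofReal (2 * ProbabilityTheory.beta (s - 1 / 2) (3 / 2) * (2 * rad T c) ^ s) := by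
  rcases Nat.eq_zero_or_pos c with rfl | hc
  · simp [Bd, rad]
  · have : NeZero c := ⟨hc.ne'⟩
    rw [← (Int.divModEquiv c).symm.tsum_eq, ENNReal.tsum_prod (f := fun q i =>
      nu s (St T ∩ Bd T c ((Int.divModEquiv c).symm (q, i)))), ENNReal.tsum_comm]
    simp only [Int.divModEquiv_symm_apply]
    simp_rw [tsum_shift hT s c, nu_Bd hT s hs hc]
    rw [tsum_fintype]
    simp_rw [Nat.isCoprime_iff_coprime]
    rw [Fin.sum_univ_eq_sum_range (fun i => if Nat.Coprime i c then
      ENNReal.ofReal (2 * ProbabilityTheory.beta (s - 1 / 2) (3 / 2) * (2 * rad T c) ^ s) else 0),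
      ← Finset.sum_filter, Finset.sum_const, nsmul_eq_mul, Nat.totient]
    simp_rw [Nat.coprime_comm]

lemma nu_union {T : ℝ} (hT : 1 ≤ T) (s : ℝ) (hs : 1 < s) :
    nu s (St T ∩ ⋃ p : ℕ × ℤ, Bd T p.1 p.2) = ∑' c : ℕ, Nat.totient c *
      ENNReal.ofReal (2 * ProbabilityTheory.beta (s - 1 / 2) (3 / 2) * (2 * rad T c) ^ s) := by
  rw [Set.inter_iUnion, measure_iUnion,
    ENNReal.tsum_prod (f := fun c a => nu s (St T ∩ Bd T c a))]
  · simp_rw [tsum_Bd hT s hs]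
  · intro p p' hpp
    refine Set.disjoint_left.2 fun z hz hz' => hpp ?_
    have := Bd_eq hT hz.2 hz'.2
    exact Prod.ext this.1 this.2
  · exact fun p => (measurableSet_St T).inter (measurableSet_Bd _ _ _)

lemma region_eq (T : ℝ) : truncatedRegion T =
    {z : ℂ | z.re ∈ Set.Icc (-1 / 2 : ℝ) (1 / 2) ∧ 0 < z.im ∧ z.im ≤ T} \
      ⋃ p : ℕ × ℤ, Bd T p.1 p.2 := by
  unfold truncatedRegion
  congr 1
  · ext z
    simp only [Set.mem_ofPred_eq, abs_le, Set.mem_Icc]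
    norm_num
  · have hp : ∀ x y : ℝ, ((x : ℝ) : ℂ) + ((y : ℝ) : ℂ) * Complex.I = ⟨x, y⟩ := by
      intro x y; apply Complex.ext <;> simp
    ext z
    simp only [Set.mem_iUnion, hp, exists_prop, Prod.exists, Bd, Set.mem_ofPred_eq]
    constructor
    · rintro ⟨c, hc, a, hac, hz⟩
      lift c to ℕ using by omega
      exact ⟨c, a, hac, by simpa [rad] using hz⟩
    · rintro ⟨c, a, hac, hz⟩
      refine ⟨c, ?_, a, hac, by simpa [rad] using hz⟩
      rcases Nat.eq_zero_or_pos c with rfl | hc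
      · simp [rad] at hz
      · exact_mod_cast hc

lemma const_eq (s : ℝ) (hs : 1 < s) :
    2 * ProbabilityTheory.beta (s - 1 / 2) (3 / 2) =
      √π * Real.Gamma (s - 1 / 2) / (s * Real.Gamma s) := by
  have h32 : Real.Gamma (3 / 2) = √π / 2 := by
    rw [show (3 / 2 : ℝ) = 1 / 2 + 1 by norm_num, Real.Gamma_add_one (by norm_num),
      Real.Gamma_one_half_eq]
    ring
  rw [ProbabilityTheory.beta, h32, show s - 1 / 2 + 3 / 2 = s + 1 by ring,
    Real.Gamma_add_one (by linarith)]
  ring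

lemma zeta_ratio (s : ℝ) (hs : 1 < s) :
    completedRiemannZeta (2 * (s : ℂ) - 1) / completedRiemannZeta (2 * (s : ℂ)) / s =
      ((2 * ProbabilityTheory.beta (s - 1 / 2) (3 / 2) : ℝ) : ℂ) *
        LSeries (fun n => (Nat.totient n : ℂ)) (2 * s : ℝ) := by
  have hΛ : ∀ u : ℂ, 0 < u.re → completedRiemannZeta u = riemannZeta u * Complex.Gammaℝ u := by
    intro u hu
    rw [riemannZeta_def_of_ne_zero (by rintro rfl; simp at hu)]
    rw [div_mul_cancel₀ _ (Complex.Gammaℝ_ne_zero_of_re_pos hu)]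
  have hL := (totient_LSeries (2 * s) (by linarith)).2
  have hz : riemannZeta (2 * s : ℝ) ≠ 0 :=
    riemannZeta_ne_zero_of_one_lt_re (by simp; linarith)
  rw [hΛ _ (by simp; linarith), hΛ _ (by simp; linarith), const_eq s hs]
  have e : riemannZeta (2 * (s : ℂ) - 1) = LSeries (fun n => (Nat.totient n : ℂ)) (2 * s : ℝ) *
      riemannZeta (2 * s : ℝ) := by rw [hL]; push_cast; rfl
  rw [e]
  push_cast at hz ⊢
  have hpi : (π : ℂ) ≠ 0 := by exact_mod_cast Real.pi_ne_zero
  have hG : Complex.Gamma s ≠ 0 := Complex.Gamma_ne_zero_of_re_pos (by simp; linarith)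
  have hs0 : (s : ℂ) ≠ 0 := by exact_mod_cast (by linarith : s ≠ 0)
  have hp0 : (π : ℂ) ^ (-(s : ℂ)) ≠ 0 := by simp [Complex.cpow_eq_zero_iff, hpi]
  rw [Complex.Gammaℝ_def, Complex.Gammaℝ_def, ← Complex.Gamma_ofReal, ← Complex.Gamma_ofReal,
    show -(2 * (s : ℂ) - 1) / 2 = -s + 1 / 2 by ring, show -(2 * (s : ℂ)) / 2 = -s by ring,
    show (2 * (s : ℂ) - 1) / 2 = s - 1 / 2 by ring, show (2 * (s : ℂ)) / 2 = s by ring,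
    Complex.cpow_add _ _ hpi, Real.sqrt_eq_rpow, Complex.ofReal_cpow Real.pi_pos.le]
  push_cast
  field_simp

lemma term_eq {T : ℝ} (hT : 1 ≤ T) (s : ℝ) (c : ℕ) :
    ((Nat.totient c : ℝ) * (2 * ProbabilityTheory.beta (s - 1 / 2) (3 / 2) * (2 * rad T c) ^ s) : ℝ) =
      ((2 * ProbabilityTheory.beta (s - 1 / 2) (3 / 2) * T ^ (-s) : ℝ) : ℂ) *
      LSeries.term (fun n => (Nat.totient n : ℂ)) (2 * s : ℝ) c := by
  rcases Nat.eq_zero_or_pos c with rfl | hc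
  · simp
  · have hc' : (0 : ℝ) < c := by exact_mod_cast hc
    rw [LSeries.term_of_ne_zero hc.ne']
    have h1 : (2 * rad T c) ^ s = T ^ (-s) / (c : ℝ) ^ (2 * s) := by
      have : 2 * rad T c = ((c : ℝ) ^ (2 : ℝ) * T)⁻¹ := by
        unfold rad; rw [Real.rpow_two]; field_simp
      rw [this, Real.inv_rpow (by positivity), Real.mul_rpow (by positivity) (by positivity),
        ← Real.rpow_mul hc'.le, Real.rpow_neg (by positivity)]
      field_simp
    have h2 : (c : ℂ) ^ ((2 * s : ℝ) : ℂ) = (((c : ℝ) ^ (2 * s) : ℝ) : ℂ) := by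
      rw [Complex.ofReal_cpow hc'.le]; simp
    rw [h1, h2]
    push_cast
    ring

end ZagierAux

/-- Zagier's truncated Rankin–Selberg formula: for real `s > 1`, the integral of
`(Im z)^{s-2}` over the truncated region equals
`T̂^{s−1}/(s−1) − (ζ*(2s−1)/ζ*(2s))·T̂^{−s}/s`. -/
theorem integral_im_rpow_truncatedRegion (That : ℝ) (hT : 1 ≤ That) (s : ℝ) (hs : 1 < s) :
    ((∫ z in truncatedRegion That, z.im ^ (s - 2) ∂volume : ℝ) : ℂ) =
      (That : ℂ) ^ ((s : ℂ) - 1) / ((s : ℂ) - 1) -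
        completedRiemannZeta (2 * (s : ℂ) - 1) / completedRiemannZeta (2 * (s : ℂ)) *
          (That : ℂ) ^ (-(s : ℂ)) / (s : ℂ) := by
  have hT0 : 0 < That := by linarith
  set U : Set ℂ := ⋃ p : ℕ × ℤ, ZagierAux.Bd That p.1 p.2 with hU
  have hUm : MeasurableSet U := MeasurableSet.iUnion fun p => ZagierAux.measurableSet_Bd _ _ _
  set S : Set ℂ := {z : ℂ | z.re ∈ Set.Icc (-1 / 2 : ℝ) (1 / 2) ∧ 0 < z.im ∧ z.im ≤ That} with hS
  have hSm : MeasurableSet S :=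
    (measurableSet_Icc.preimage Complex.measurable_re).inter
      ((measurableSet_Ioc (a := (0:ℝ)) (b := That)).preimage Complex.measurable_im)
  have hR : truncatedRegion That = S \ U := ZagierAux.region_eq That
  have hRm : MeasurableSet (truncatedRegion That) := by rw [hR]; exact hSm.diff hUm
  have hnS : ZagierAux.nu s S = ENNReal.ofReal (That ^ (s - 1) / (s - 1)) :=
    ZagierAux.nu_strip s That hs hT measurableSet_Icc (by rw [Real.volume_Icc]; norm_num)
  have hnS' : ZagierAux.nu s (ZagierAux.St That) = ENNReal.ofReal (That ^ (s - 1) / (s - 1)) :=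
    ZagierAux.nu_strip s That hs hT measurableSet_Ioc (by rw [Real.volume_Ioc]; norm_num)
  have hsub : ZagierAux.St That ⊆ S := fun z hz => ⟨Set.Ioc_subset_Icc_self hz.1, hz.2⟩
  have hae : ZagierAux.St That =ᵐ[ZagierAux.nu s] S :=
    ae_eq_of_subset_of_measure_ge hsub (by rw [hnS, hnS'])
      (ZagierAux.measurableSet_St That).nullMeasurableSet (by rw [hnS]; exact ENNReal.ofReal_ne_top)
  -- the sum
  set f : ℕ → ℝ := fun c => (Nat.totient c : ℝ) *
    (2 * ProbabilityTheory.beta (s - 1 / 2) (3 / 2) * (2 * ZagierAux.rad That c) ^ s) with hf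
  have hb : 0 < ProbabilityTheory.beta (s - 1 / 2) (3 / 2) :=
    ProbabilityTheory.beta_pos (by linarith) (by norm_num)
  have hf0 : ∀ c, 0 ≤ f c := by
    intro c
    have : 0 ≤ ZagierAux.rad That c := by unfold ZagierAux.rad; positivity
    positivity
  have hLs := (ZagierAux.totient_LSeries (2 * s) (by linarith)).1
  have hfC : HasSum (fun c => (f c : ℂ))
      (((2 * ProbabilityTheory.beta (s - 1 / 2) (3 / 2) * That ^ (-s) : ℝ) : ℂ) *
      LSeries (fun n => (Nat.totient n : ℂ)) (2 * s : ℝ)) := by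
    have := hLs.LSeriesHasSum.mul_left
      ((2 * ProbabilityTheory.beta (s - 1 / 2) (3 / 2) * That ^ (-s) : ℝ) : ℂ)
    refine this.congr_fun ?_
    intro c
    exact ZagierAux.term_eq hT s c
  have hfs : Summable f := Complex.summable_ofReal.mp hfC.summable
  have hfT : ((∑' c, f c : ℝ) : ℂ) = _ := (Complex.ofReal_tsum f).trans hfC.tsum_eq
  have hnU : ZagierAux.nu s (ZagierAux.St That ∩ U) = ENNReal.ofReal (∑' c, f c) := by
    rw [ENNReal.ofReal_tsum_of_nonneg hf0 hfs, ZagierAux.nu_union hT s hs]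
    congr 1
    ext c
    rw [← ENNReal.ofReal_natCast, ← ENNReal.ofReal_mul (by positivity)]
  have hnR : ZagierAux.nu s (truncatedRegion That) =
      ENNReal.ofReal (That ^ (s - 1) / (s - 1)) - ENNReal.ofReal (∑' c, f c) := by
    rw [hR, ← measure_congr (hae.diff (ae_eq_refl U)),
      ← Set.sdiff_self_inter, measure_sdiff Set.inter_subset_left
        ((ZagierAux.measurableSet_St That).inter hUm).nullMeasurableSet
        (by rw [hnU]; exact ENNReal.ofReal_ne_top), hnU, hnS']
  have hint : ∫ z in truncatedRegion That, z.im ^ (s - 2) ∂volume =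
      That ^ (s - 1) / (s - 1) - ∑' c, f c := by
    rw [integral_eq_lintegral_of_nonneg_ae]
    · have : ∫⁻ z in truncatedRegion That, ENNReal.ofReal (z.im ^ (s - 2)) ∂volume =
        ZagierAux.nu s (truncatedRegion That) := by
        rw [ZagierAux.nu, withDensity_apply _ hRm]
      rw [this, hnR, ← ENNReal.ofReal_sub _ (tsum_nonneg hf0), ENNReal.toReal_ofReal]
      have hle := measure_mono (μ := ZagierAux.nu s)
        (Set.inter_subset_left : ZagierAux.St That ∩ U ⊆ ZagierAux.St That)
      rw [hnU, hnS', ENNReal.ofReal_le_ofReal_iff] at hle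
      · linarith
      · have : 0 < s - 1 := by linarith
        positivity
    · filter_upwards [ae_restrict_mem hRm] with z hz
      exact Real.rpow_nonneg hz.1.2.1.le _
    · exact (by fun_prop : Measurable fun z : ℂ => z.im ^ (s - 2)).aestronglyMeasurable
  rw [hint, Complex.ofReal_sub, hfT, Complex.ofReal_div, Complex.ofReal_cpow hT0.le]
  have hz := ZagierAux.zeta_ratio s hs
  rw [mul_div_right_comm, hz, Complex.ofReal_mul _ (That ^ (-s)), Complex.ofReal_cpow hT0.le]
  push_cast
  ring
end

section
/- Let T̂ ≥ 1 be a real number and let R(T̂) be the subset of ℂ consisting of all z = x + iy with |x| ≤ 1/2 and 0 < y ≤ T̂, with the open disc of radius 1/(2c²T̂) centered at a/c + i/(2c²T̂) removed for every integer c ≥ 1 and every integer a coprime to c. Then for every real s > 1, the integral of (Im z)^{s−2}·log(Im z) over R(T̂) with respect to planar Lebesgue measure equals the derivative at s of the function s ↦ T̂^{s−1}/(s−1) − (ζ*(2s−1)/ζ*(2s))·T̂^{−s}/s. -/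
open Filter Real Topology MeasureTheory

lemma mem_ford {p r : ℝ} (hr : 0 < r) (z : ℂ) :
    z ∈ Metric.ball ((p : ℂ) + (r : ℂ) * Complex.I) r ↔
      (z.re - p) ^ 2 + (z.im - r) ^ 2 < r ^ 2 := by
  rw [Metric.mem_ball, Complex.dist_eq_re_im, Real.sqrt_lt' hr]
  simp

lemma ford_im {p r : ℝ} (hr : 0 < r) {z : ℂ}
    (h : z ∈ Metric.ball ((p : ℂ) + (r : ℂ) * Complex.I) r) : 0 < z.im ∧ z.im < 2 * r := by
  rw [mem_ford hr] at h
  constructor <;> nlinarith [sq_nonneg (z.re - p)]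

lemma ford_disjoint {T : ℝ} (hT : 1 ≤ T) {a c a' c' : ℤ} (hc : 1 ≤ c) (hc' : 1 ≤ c')
    (h : a * c' ≠ a' * c) :
    Disjoint
      (Metric.ball (((a : ℝ) / (c : ℝ) : ℝ) + ((1 / (2 * (c : ℝ) ^ 2 * T) : ℝ) : ℂ) * Complex.I)
        (1 / (2 * (c : ℝ) ^ 2 * T)))
      (Metric.ball (((a' : ℝ) / (c' : ℝ) : ℝ) + ((1 / (2 * (c' : ℝ) ^ 2 * T) : ℝ) : ℂ) * Complex.I)
        (1 / (2 * (c' : ℝ) ^ 2 * T))) := by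
  apply Metric.ball_disjoint_ball
  rw [Complex.dist_eq_re_im]
  apply Real.le_sqrt_of_sq_le
  have hcr : (1 : ℝ) ≤ c := by exact_mod_cast hc
  have hcr' : (1 : ℝ) ≤ c' := by exact_mod_cast hc'
  have h1 : (1 : ℝ) ≤ ((a : ℝ) * c' - a' * c) ^ 2 := by
    have : (1 : ℤ) ≤ (a * c' - a' * c) ^ 2 := by
      have : a * c' - a' * c ≠ 0 := sub_ne_zero.mpr h
      have : 0 < (a * c' - a' * c) ^ 2 := by positivity
      omega
    exact_mod_cast this
  simp only [Complex.add_re, Complex.ofReal_re, Complex.mul_re, Complex.I_re, Complex.I_im,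
    Complex.ofReal_im, Complex.add_im, Complex.mul_im, mul_zero, mul_one, sub_zero,
    zero_add, add_zero]
  have h2 : ((a : ℝ) / c - a' / c') ^ 2 = ((a : ℝ) * c' - a' * c) ^ 2 / (c * c') ^ 2 := by
    field_simp
  have h3 : 4 * (1 / (2 * (c : ℝ) ^ 2 * T)) * (1 / (2 * (c' : ℝ) ^ 2 * T)) =
      (1 / T ^ 2) / (c * c') ^ 2 := by
    field_simp
    norm_num
  have h4 : 1 / T ^ 2 ≤ 1 := by
    rw [div_le_one (by positivity)]
    nlinarith
  have h5 : (1 / T ^ 2) / ((c : ℝ) * c') ^ 2 ≤ ((a : ℝ) * c' - a' * c) ^ 2 / (c * c') ^ 2 := by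
    gcongr
    linarith
  nlinarith

lemma volume_re_eq (x : ℝ) : volume {z : ℂ | z.re = x} = 0 := by
  have : {z : ℂ | z.re = x} = Complex.measurableEquivRealProd ⁻¹' ({x} ×ˢ Set.univ) := by
    ext z; simp
  rw [this, Complex.volume_preserving_equiv_real_prod.measure_preimage_equiv,
    Measure.volume_eq_prod, Measure.prod_prod]
  simp

lemma strip_fold {T p r : ℝ} (hr : 0 < r) (hrT : 2 * r ≤ T) (g : ℝ → ENNReal) :
    ∑' k : ℤ, ∫⁻ z in {z : ℂ | |z.re| ≤ 1 / 2 ∧ 0 < z.im ∧ z.im ≤ T} ∩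
      Metric.ball (((p + k : ℝ) : ℂ) + (r : ℂ) * Complex.I) r, g z.im =
    ∫⁻ z in Metric.ball ((p : ℂ) + (r : ℂ) * Complex.I) r, g z.im := by
  have hU : Metric.ball ((p : ℂ) + (r : ℂ) * Complex.I) r =
      ⋃ k : ℤ, {z : ℂ | -(1/2) < z.re + k ∧ z.re + k ≤ 1 / 2} ∩
        Metric.ball ((p : ℂ) + (r : ℂ) * Complex.I) r := by
    rw [← Set.iUnion_inter]
    symm
    rw [Set.inter_eq_right]
    intro z _
    rw [Set.mem_iUnion]
    refine ⟨-⌈z.re - 1 / 2⌉, ?_⟩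
    have h1 := Int.ceil_lt_add_one (z.re - 1 / 2)
    have h2 := Int.le_ceil (z.re - 1 / 2)
    simp only [Set.mem_ofPred_eq]
    push_cast
    constructor <;> linarith
  conv_rhs => rw [hU]
  rw [lintegral_iUnion]
  · congr 1
    ext k
    have h1 : ({z : ℂ | |z.re| ≤ 1 / 2 ∧ 0 < z.im ∧ z.im ≤ T} ∩
      Metric.ball (((p + k : ℝ) : ℂ) + (r : ℂ) * Complex.I) r : Set ℂ) =ᵐ[volume]
        ({z : ℂ | -(1/2) < z.re ∧ z.re ≤ 1 / 2} ∩
      Metric.ball (((p + k : ℝ) : ℂ) + (r : ℂ) * Complex.I) r : Set ℂ) := by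
      have : ∀ᵐ z : ℂ, z.re ≠ -(1/2) := by
        rw [ae_iff]; simpa using volume_re_eq (-(1/2))
      filter_upwards [this] with z hz
      apply propext
      change (_ ∧ _) ↔ (_ ∧ _)
      refine and_congr_left fun hb => ?_
      have := ford_im hr hb
      simp only [Set.mem_ofPred_eq, abs_le]
      constructor
      · rintro ⟨⟨h1, h2⟩, _⟩
        exact ⟨lt_of_le_of_ne h1 (Ne.symm hz), h2⟩
      · rintro ⟨h1, h2⟩
        exact ⟨⟨h1.le, h2⟩, this.1, by linarith⟩
    rw [setLIntegral_congr h1]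
    have hmp := measurePreserving_add_right (volume : Measure ℂ) (k : ℂ)
    rw [← hmp.setLIntegral_comp_preimage_emb (measurableEmbedding_addRight (k : ℂ))]
    have h2 : (fun x : ℂ => x + k) ⁻¹' ({z : ℂ | -(1/2) < z.re ∧ z.re ≤ 1 / 2} ∩
      Metric.ball (((p + k : ℝ) : ℂ) + (r : ℂ) * Complex.I) r : Set ℂ) =
      {z : ℂ | -(1/2) < z.re + k ∧ z.re + k ≤ 1 / 2} ∩
        Metric.ball ((p : ℂ) + (r : ℂ) * Complex.I) r := by
      ext z
      simp only [Set.mem_preimage, Set.mem_inter_iff, mem_ford hr]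
      simp
    rw [h2]
    simp
  · intro k
    refine MeasurableSet.inter ?_ measurableSet_ball
    have hm : Measurable (fun z : ℂ => z.re + (k : ℝ)) := by fun_prop
    exact (measurableSet_lt measurable_const hm).inter (measurableSet_le hm measurable_const)
  · intro k l hkl
    rw [Function.onFun, Set.disjoint_left]
    rintro z ⟨⟨h1, h2⟩, _⟩ ⟨⟨h3, h4⟩, _⟩
    apply hkl
    have h5 : (k : ℝ) < l + 1 := by linarith
    have h6 : (l : ℝ) < k + 1 := by linarith
    norm_cast at h5 h6
    omega

lemma lint_beta {a b : ℝ} (ha : 0 < a) (hb : 0 < b) :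
    ∫⁻ x in Set.Ioo (0 : ℝ) 1, ENNReal.ofReal (x ^ (a - 1) * (1 - x) ^ (b - 1)) =
      ENNReal.ofReal (Real.Gamma a * Real.Gamma b / Real.Gamma (a + b)) := by
  have h := ProbabilityTheory.lintegral_betaPDF_eq_one ha hb
  have hp := ProbabilityTheory.beta_pos ha hb
  rw [ProbabilityTheory.lintegral_betaPDF] at h
  simp_rw [mul_assoc, ENNReal.ofReal_mul (one_div_pos.mpr hp).le] at h
  rw [lintegral_const_mul' _ _ ENNReal.ofReal_ne_top, one_div, ENNReal.ofReal_inv_of_pos hp] at h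
  change _ = ENNReal.ofReal (ProbabilityTheory.beta a b)
  rw [ENNReal.eq_inv_of_mul_eq_one_left ((mul_comm _ _).trans h), inv_inv]

lemma lint_line {D w : ℝ} (hD : 0 < D) (hw : 1 < w) :
    ∫⁻ y in Set.Ioo 0 D, ENNReal.ofReal (y ^ (w - 2)) * ENNReal.ofReal (2 * √(D * y - y ^ 2)) =
      ENNReal.ofReal (D ^ w * (√π * Real.Gamma (w - 1 / 2) / Real.Gamma (w + 1))) := by
  have himg : Set.Ioo 0 D = (fun x => D * x) '' Set.Ioo (0 : ℝ) 1 := by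
    rw [Set.image_mul_left_Ioo hD]; simp
  rw [himg, lintegral_image_eq_lintegral_abs_deriv_mul (f' := fun _ => D) measurableSet_Ioo
    (fun x _ => by simpa using ((hasDerivAt_id x).const_mul D).hasDerivWithinAt)
    (fun x _ y _ h => mul_left_cancel₀ hD.ne' h)]
  have hb := lint_beta (a := w - 1 / 2) (b := 3 / 2) (by linarith) (by norm_num)
  have hg : Real.Gamma (3 / 2) = √π / 2 := by
    rw [show (3 / 2 : ℝ) = 1 / 2 + 1 by norm_num, Real.Gamma_add_one (by norm_num),
      Real.Gamma_one_half_eq]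
    ring
  have key : ∀ x ∈ Set.Ioo (0 : ℝ) 1, ENNReal.ofReal |D| * (ENNReal.ofReal ((D * x) ^ (w - 2)) *
      ENNReal.ofReal (2 * √(D * (D * x) - (D * x) ^ 2))) =
      ENNReal.ofReal (2 * D ^ w) *
        ENNReal.ofReal (x ^ (w - 1 / 2 - 1) * (1 - x) ^ ((3 : ℝ) / 2 - 1)) := by
    rintro x ⟨h0, h1⟩
    rw [← ENNReal.ofReal_mul (by positivity), ← ENNReal.ofReal_mul (by positivity),
      ← ENNReal.ofReal_mul (by positivity), abs_of_pos hD]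
    congr 1
    have e1 : √(D * (D * x) - (D * x) ^ 2) = D * x ^ (1 / 2 : ℝ) * (1 - x) ^ (1 / 2 : ℝ) := by
      rw [show D * (D * x) - (D * x) ^ 2 = D ^ 2 * (x * (1 - x)) by ring,
        Real.sqrt_mul (by positivity), Real.sqrt_sq hD.le, Real.sqrt_mul h0.le,
        Real.sqrt_eq_rpow, Real.sqrt_eq_rpow]
      ring
    have e2 : D ^ w = D ^ (w - 2) * D * D := by
      rw [mul_assoc, ← pow_two, ← Real.rpow_natCast D 2, ← Real.rpow_add hD]
      congr 1; push_cast; ring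
    have e3 : x ^ (w - 1 / 2 - 1) = x ^ (w - 2) * x ^ (1 / 2 : ℝ) := by
      rw [← Real.rpow_add h0]; congr 1; ring
    rw [e1, e2, e3, Real.mul_rpow hD.le h0.le, show (3 : ℝ) / 2 - 1 = 1 / 2 by norm_num]
    ring
  rw [setLIntegral_congr_fun measurableSet_Ioo key,
    lintegral_const_mul' _ _ ENNReal.ofReal_ne_top, hb, ← ENNReal.ofReal_mul (by positivity), hg,
    show w - 1 / 2 + 3 / 2 = w + 1 by ring]
  congr 1
  ring

lemma lint_ford {p r w : ℝ} (hr : 0 < r) (hw : 1 < w) :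
    ∫⁻ z in Metric.ball ((p : ℂ) + (r : ℂ) * Complex.I) r, ENNReal.ofReal (z.im ^ (w - 2)) =
      ENNReal.ofReal ((2 * r) ^ w * (√π * Real.Gamma (w - 1 / 2) / Real.Gamma (w + 1))) := by
  rw [← lint_line (by positivity) hw, ← lintegral_indicator measurableSet_ball,
    ← lintegral_indicator measurableSet_Ioo]
  have hmp := Complex.volume_preserving_equiv_real_prod.symm
  rw [← hmp.lintegral_comp_emb (MeasurableEquiv.measurableEmbedding _), Measure.volume_eq_prod,
    lintegral_prod_symm]
  · congr 1
    ext y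
    have hx : ∀ x : ℝ, (Metric.ball ((p : ℂ) + (r : ℂ) * Complex.I) r).indicator
        (fun z : ℂ => ENNReal.ofReal (z.im ^ (w - 2)))
          (Complex.measurableEquivRealProd.symm (x, y)) =
        (Set.Ioo (p - √(2 * r * y - y ^ 2)) (p + √(2 * r * y - y ^ 2))).indicator
          (fun _ => ENNReal.ofReal (y ^ (w - 2))) x := by
      intro x
      have : Complex.measurableEquivRealProd.symm (x, y) ∈
          Metric.ball ((p : ℂ) + (r : ℂ) * Complex.I) r ↔
          x ∈ Set.Ioo (p - √(2 * r * y - y ^ 2)) (p + √(2 * r * y - y ^ 2)) := by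
        rw [mem_ford hr]
        have h1 : x ∈ Set.Ioo (p - √(2 * r * y - y ^ 2)) (p + √(2 * r * y - y ^ 2)) ↔
            |x - p| < √(2 * r * y - y ^ 2) := by
          rw [abs_lt, Set.mem_Ioo]
          constructor <;> rintro ⟨h1, h2⟩ <;> constructor <;> linarith
        rw [h1, Real.lt_sqrt (abs_nonneg _), sq_abs]
        simp only [Complex.measurableEquivRealProd_symm_apply]
        constructor <;> intro h <;> linarith
      by_cases hm : x ∈ Set.Ioo (p - √(2 * r * y - y ^ 2)) (p + √(2 * r * y - y ^ 2))
      · rw [Set.indicator_of_mem hm, Set.indicator_of_mem (this.mpr hm)]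
        simp
      · rw [Set.indicator_of_notMem hm, Set.indicator_of_notMem (mt this.mp hm)]
    simp_rw [hx]
    rw [lintegral_indicator measurableSet_Ioo, setLIntegral_const, Real.volume_Ioo]
    by_cases hy : y ∈ Set.Ioo 0 (2 * r)
    · rw [Set.indicator_of_mem hy]
      congr 2
      ring
    · rw [Set.indicator_of_notMem hy, Real.sqrt_eq_zero_of_nonpos]
      · simp
      · rw [Set.mem_Ioo, not_and_or, not_lt, not_lt] at hy
        rcases hy with hy | hy <;> nlinarith
  · have hm : Measurable ((Metric.ball ((p : ℂ) + (r : ℂ) * Complex.I) r).indicator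
        (fun z : ℂ => ENNReal.ofReal (z.im ^ (w - 2)))) :=
      Measurable.indicator (by fun_prop) measurableSet_ball
    exact (hm.comp (MeasurableEquiv.measurable _)).aemeasurable

lemma LSeries_totient {w : ℝ} (hw : 1 < w) :
    LSeriesSummable (fun n => ((Nat.totient n : ℕ) : ℂ)) (2 * w : ℂ) ∧
    LSeries (fun n => ((Nat.totient n : ℕ) : ℂ)) (2 * w : ℂ) =
      riemannZeta (2 * w - 1) / riemannZeta (2 * w) := by
  have hre : ((2 * w : ℂ)).re = 2 * w := by simp
  have hre1 : ((2 * w - 1 : ℂ)).re = 2 * w - 1 := by simp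
  have hS : LSeriesSummable (fun n => ((Nat.totient n : ℕ) : ℂ)) (2 * w : ℂ) := by
    apply LSeriesSummable_of_le_const_mul_rpow (x := 2) (by rw [hre]; linarith)
    refine ⟨1, fun n hn => ?_⟩
    rw [show (2 : ℝ) - 1 = 1 by norm_num, Real.rpow_one, one_mul, Complex.norm_natCast]
    exact_mod_cast Nat.totient_le n
  refine ⟨hS, ?_⟩
  have h1 : 1 < ((2 * w : ℂ)).re := by rw [hre]; linarith
  have h1S : LSeriesSummable 1 (2 * w : ℂ) := LSeriesSummable_one_iff.mpr h1
  rw [eq_div_iff (riemannZeta_ne_zero_of_one_lt_re h1), ← LSeries_one_eq_riemannZeta h1,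
    ← LSeries_convolution' hS h1S, zeta_eq_tsum_one_div_nat_cpow (by rw [hre1]; linarith), LSeries]
  congr 1
  ext n
  rcases eq_or_ne n 0 with rfl | hn
  · have hne : (2 * w - 1 : ℂ) ≠ 0 := by
      intro h
      have := congrArg Complex.re h
      rw [hre1] at this
      simp at this
      linarith
    simp [Complex.zero_cpow hne]
  · rw [LSeries.term_of_ne_zero hn, LSeries.convolution_def]
    have : ∑ p ∈ n.divisorsAntidiagonal, ((Nat.totient p.1 : ℕ) : ℂ) * (1 : ℕ → ℂ) p.2 = n := by
      simp only [Pi.one_apply, mul_one]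
      rw [Nat.sum_divisorsAntidiagonal (f := fun i _ => ((Nat.totient i : ℕ) : ℂ))]
      exact_mod_cast Nat.sum_totient n
    have hn' : (n : ℂ) ≠ 0 := by exact_mod_cast hn
    simp only [this]
    rw [Complex.cpow_sub _ _ hn', Complex.cpow_one]
    field_simp

lemma totient_sum {w : ℝ} (hw : 1 < w) :
    ∃ Z : ℝ, HasSum (fun n : ℕ => (Nat.totient (n + 1) : ℝ) * (((n : ℝ) + 1) ^ 2) ^ (-w)) Z ∧
      (Z : ℂ) = riemannZeta (2 * w - 1) / riemannZeta (2 * w) := by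
  obtain ⟨hS, hL⟩ := LSeries_totient hw
  have hs := hS.LSeriesHasSum
  rw [hL, LSeriesHasSum, ← hasSum_nat_add_iff' 1] at hs
  have ht : ∀ n : ℕ, LSeries.term (fun n => ((Nat.totient n : ℕ) : ℂ)) (2 * w : ℂ) (n + 1) =
      (((Nat.totient (n + 1) : ℝ) * (((n : ℝ) + 1) ^ 2) ^ (-w) : ℝ) : ℂ) := by
    intro n
    rw [LSeries.term_of_ne_zero (by omega)]
    have : (((n + 1 : ℕ) : ℂ)) ^ (2 * w : ℂ) = (((((n : ℝ) + 1) ^ 2) ^ w : ℝ) : ℂ) := by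
      rw [← Real.rpow_natCast, ← Real.rpow_mul (by positivity), Complex.ofReal_cpow (by positivity)]
      push_cast
      rfl
    rw [this, Real.rpow_neg (by positivity)]
    push_cast
    rw [div_eq_mul_inv]
  simp only [ht, Finset.range_one, Finset.sum_singleton, LSeries.term_zero, sub_zero] at hs
  have hsr := Complex.hasSum_re hs
  simp only [Complex.ofReal_re] at hsr
  refine ⟨_, hsr, ?_⟩
  exact (Complex.hasSum_ofReal.mpr hsr).unique hs

lemma completed_ratio {w : ℝ} (hw : 1 < w) :
    completedRiemannZeta (2 * w - 1) / completedRiemannZeta (2 * w) / w =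
      riemannZeta (2 * w - 1) / riemannZeta (2 * w) *
        ((√π * Real.Gamma (w - 1 / 2) / Real.Gamma (w + 1) : ℝ) : ℂ) := by
  have hw0 : (w : ℂ) ≠ 0 := by exact_mod_cast (by linarith : w ≠ 0)
  have h1 : (2 * w - 1 : ℂ) ≠ 0 := by exact_mod_cast (by linarith : 2 * w - 1 ≠ 0)
  have h2 : (2 * w : ℂ) ≠ 0 := by simpa using hw0
  have hz : riemannZeta (2 * w) ≠ 0 := riemannZeta_ne_zero_of_one_lt_re (by simp; linarith)
  have hc : completedRiemannZeta (2 * w) ≠ 0 := by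
    intro h
    rw [riemannZeta_def_of_ne_zero h2, h] at hz
    simp at hz
  rw [riemannZeta_def_of_ne_zero h1, riemannZeta_def_of_ne_zero h2]
  have e1 : Complex.Gammaℝ (2 * w - 1) =
      ((π ^ (-(w - 1 / 2)) * Real.Gamma (w - 1 / 2) : ℝ) : ℂ) := by
    rw [Complex.Gammaℝ_def, Complex.ofReal_mul, Complex.ofReal_cpow pi_pos.le,
      ← Complex.Gamma_ofReal]
    push_cast
    congr 2 <;> ring
  have e2 : Complex.Gammaℝ (2 * w) = ((π ^ (-w) * Real.Gamma w : ℝ) : ℂ) := by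
    rw [Complex.Gammaℝ_def, Complex.ofReal_mul, Complex.ofReal_cpow pi_pos.le,
      ← Complex.Gamma_ofReal]
    push_cast
    congr 2 <;> ring
  have g1 := (Real.Gamma_pos_of_pos (by linarith : 0 < w - 1 / 2)).ne'
  have g2 := (Real.Gamma_pos_of_pos (by linarith : 0 < w)).ne'
  have g3 : π ^ (-(w - 1 / 2)) = π ^ (-w) * √π := by
    rw [Real.sqrt_eq_rpow, ← Real.rpow_add pi_pos]
    congr 1; ring
  have g4 : π ^ (-w) ≠ 0 := (Real.rpow_pos_of_pos pi_pos _).ne'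
  have g5 : √π ≠ 0 := by positivity
  rw [e1, e2, g3, Real.Gamma_add_one (by linarith)]
  push_cast
  have g1' : ((Real.Gamma (w - 1 / 2) : ℝ) : ℂ) ≠ 0 := by exact_mod_cast g1
  have g2' : ((Real.Gamma w : ℝ) : ℂ) ≠ 0 := by exact_mod_cast g2
  have g4' : ((π ^ (-w) : ℝ) : ℂ) ≠ 0 := by exact_mod_cast g4
  have g5' : ((√π : ℝ) : ℂ) ≠ 0 := by exact_mod_cast g5
  generalize ((Real.Gamma (w - 1 / 2) : ℝ) : ℂ) = G at *
  field_simp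

lemma strip_integral {T : ℝ} {g : ℝ → ℝ} (hg : IntegrableOn g (Set.Ioc 0 T)) :
    IntegrableOn (fun z : ℂ => g z.im) {z : ℂ | |z.re| ≤ 1 / 2 ∧ 0 < z.im ∧ z.im ≤ T} ∧
    ∫ z in {z : ℂ | |z.re| ≤ 1 / 2 ∧ 0 < z.im ∧ z.im ≤ T}, g z.im = ∫ y in Set.Ioc 0 T, g y := by
  have hS : {z : ℂ | |z.re| ≤ 1 / 2 ∧ 0 < z.im ∧ z.im ≤ T} =
      Complex.measurableEquivRealProd ⁻¹' (Set.Icc (-(1/2)) (1/2) ×ˢ Set.Ioc 0 T) := by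
    ext z; simp [abs_le]
  have hmp := Complex.volume_preserving_equiv_real_prod
  have hemb := Complex.measurableEquivRealProd.measurableEmbedding
  have hi : IntegrableOn (fun p : ℝ × ℝ => (1 : ℝ) * g p.2)
      (Set.Icc (-(1/2)) (1/2) ×ˢ Set.Ioc 0 T) := by
    rw [IntegrableOn, Measure.volume_eq_prod, ← Measure.prod_restrict]
    have h1 : Integrable (fun _ : ℝ => (1 : ℝ)) (volume.restrict (Set.Icc (-(1/2) : ℝ) (1/2))) :=
      integrable_const 1
    exact h1.mul_prod hg
  rw [hS]
  constructor
  · have := (hmp.integrableOn_comp_preimage hemb).mpr hi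
    simpa [Function.comp_def] using this
  · have := hmp.setIntegral_preimage_emb hemb (fun p : ℝ × ℝ => (1 : ℝ) * g p.2)
      (Set.Icc (-(1/2)) (1/2) ×ˢ Set.Ioc 0 T)
    simp only [Complex.measurableEquivRealProd_apply, one_mul] at this
    rw [this]
    have h2 := setIntegral_prod_mul (μ := (volume : Measure ℝ)) (ν := (volume : Measure ℝ))
      (fun _ : ℝ => (1 : ℝ)) g (Set.Icc (-(1/2)) (1/2)) (Set.Ioc 0 T)
    rw [← Measure.volume_eq_prod] at h2
    simp only [one_mul] at h2
    rw [h2]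
    norm_num

lemma rpow_int {T a : ℝ} (hT : 0 ≤ T) (ha : -1 < a) :
    IntegrableOn (fun y : ℝ => y ^ a) (Set.Ioc 0 T) ∧
      ∫ y in Set.Ioc 0 T, y ^ a = T ^ (a + 1) / (a + 1) := by
  constructor
  · exact (intervalIntegrable_iff_integrableOn_Ioc_of_le hT).mp
      (intervalIntegral.intervalIntegrable_rpow' ha)
  · rw [← intervalIntegral.integral_of_le hT, integral_rpow (Or.inl ha), Real.zero_rpow (by linarith)]
    ring

lemma measurable_strip (T : ℝ) :
    MeasurableSet {z : ℂ | |z.re| ≤ 1 / 2 ∧ 0 < z.im ∧ z.im ≤ T} := by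
  have h1 : Measurable (fun z : ℂ => |z.re|) := by fun_prop
  exact (measurableSet_le h1 measurable_const).inter
    ((measurableSet_lt measurable_const Complex.measurable_im).inter
      (measurableSet_le Complex.measurable_im measurable_const))

lemma bound_aux {a b d w y : ℝ} (hd : 0 < d) (hy : 0 < y) (ha : a ≤ w) (hb : w ≤ b) :
    |y ^ w * Real.log y| ≤ 1 / d * (y ^ (a + d) + y ^ (a - d) + y ^ (b + d) + y ^ (b - d)) := by
  have h1 : y ^ w ≤ y ^ a + y ^ b := by
    rcases le_total y 1 with h | h
    · have := Real.rpow_le_rpow_of_exponent_ge hy h ha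
      have := Real.rpow_pos_of_pos hy b
      linarith
    · have := Real.rpow_le_rpow_of_exponent_le h hb
      have := Real.rpow_pos_of_pos hy a
      linarith
  have h2 : |Real.log y| ≤ 1 / d * (y ^ d + y ^ (-d)) := by
    have e1 := Real.log_le_rpow_div hy.le hd
    have e2 := Real.log_le_rpow_div (inv_pos.mpr hy).le hd
    rw [Real.log_inv, Real.inv_rpow hy.le, ← Real.rpow_neg hy.le] at e2
    have := Real.rpow_pos_of_pos hy d
    have := Real.rpow_pos_of_pos hy (-d)
    have p1 : 0 < y ^ d / d := by positivity
    have p2 : 0 < y ^ (-d) / d := by positivity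
    rw [mul_add, one_div_mul_eq_div, one_div_mul_eq_div, abs_le]
    constructor <;> linarith
  have hp := Real.rpow_pos_of_pos hy w
  rw [abs_mul, abs_of_pos hp]
  calc y ^ w * |Real.log y| ≤ (y ^ a + y ^ b) * (1 / d * (y ^ d + y ^ (-d))) := by gcongr
    _ = _ := by
      rw [Real.rpow_add hy, Real.rpow_add hy, sub_eq_add_neg, sub_eq_add_neg, Real.rpow_add hy,
        Real.rpow_add hy]
      ring

lemma deriv_under {T s : ℝ} (hT : 0 ≤ T) (hs : 1 < s) {R : Set ℂ}
    (hR : R ⊆ {z : ℂ | |z.re| ≤ 1 / 2 ∧ 0 < z.im ∧ z.im ≤ T}) (hRm : MeasurableSet R) :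
    HasDerivAt (fun w : ℝ => ∫ z in R, z.im ^ (w - 2))
      (∫ z in R, z.im ^ (s - 2) * Real.log z.im) s := by
  set d := (s - 1) / 4 with hd
  have hd0 : 0 < d := by rw [hd]; linarith
  have hI : ∀ a : ℝ, -1 < a → IntegrableOn (fun z : ℂ => z.im ^ a) R := fun a ha =>
    ((strip_integral (rpow_int hT ha).1).1).mono_set hR
  refine (hasDerivAt_integral_of_dominated_loc_of_deriv_le
    (F := fun (w : ℝ) (z : ℂ) => z.im ^ (w - 2))
    (F' := fun (w : ℝ) (z : ℂ) => z.im ^ (w - 2) * Real.log z.im)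
    (bound := fun z : ℂ => 1 / d * (z.im ^ (s - 2 - d + d) + z.im ^ (s - 2 - d - d) +
      z.im ^ (s - 2 + d + d) + z.im ^ (s - 2 + d - d)))
    (Icc_mem_nhds (show s - d < s by linarith) (show s < s + d by linarith)) ?_ ?_ ?_ ?_ ?_ ?_).2
  · exact Eventually.of_forall fun w => (by fun_prop : Measurable _).aestronglyMeasurable
  · exact hI _ (by linarith)
  · exact (by fun_prop : Measurable _).aestronglyMeasurable
  · refine (ae_restrict_iff' hRm).mpr (Eventually.of_forall fun z hz w hw => ?_)
    exact bound_aux hd0 (hR hz).2.1 (by linarith [hw.1]) (by linarith [hw.2])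
  · refine Integrable.const_mul ?_ _
    exact (((hI _ (by linarith)).add (hI _ (by linarith))).add (hI _ (by linarith))).add
      (hI _ (by linarith))
  · refine (ae_restrict_iff' hRm).mpr (Eventually.of_forall fun z hz w hw => ?_)
    have := ((hasDerivAt_id w).sub_const 2).const_rpow (hR hz).2.1
    exact this.congr_deriv (by simp only [id]; ring)

/-- Index type for the discs: a denominator `n + 1`, a reduced residue and an integer shift. -/
abbrev FordIdx : Type :=
  (n : ℕ) × ({b : ℕ // b ∈ (Finset.range (n + 1)).filter (n + 1).Coprime} × ℤ)

/-- The disc attached to an index. -/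
def fordDisc (T : ℝ) (i : FordIdx) : Set ℂ :=
  Metric.ball ((((((i.2.1 : ℕ) : ℝ) / ((i.1 : ℝ) + 1)) + (i.2.2 : ℤ) : ℝ) : ℂ) +
    ((1 / (2 * ((i.1 : ℝ) + 1) ^ 2 * T) : ℝ) : ℂ) * Complex.I) (1 / (2 * ((i.1 : ℝ) + 1) ^ 2 * T))

lemma fordDisc_eq (T : ℝ) (i : FordIdx) : fordDisc T i =
    Metric.ball ((((((i.2.1 : ℕ) + i.2.2 * (i.1 + 1) : ℤ) : ℝ) / (((i.1 : ℤ) + 1 : ℤ) : ℝ) : ℝ) : ℂ) +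
      ((1 / (2 * (((i.1 : ℤ) + 1 : ℤ) : ℝ) ^ 2 * T) : ℝ) : ℂ) * Complex.I)
        (1 / (2 * (((i.1 : ℤ) + 1 : ℤ) : ℝ) ^ 2 * T)) := by
  have h : (((i.2.1 : ℕ) + i.2.2 * (i.1 + 1) : ℤ) : ℝ) / (((i.1 : ℤ) + 1 : ℤ) : ℝ) =
      (((i.2.1 : ℕ) : ℝ) / ((i.1 : ℝ) + 1)) + (i.2.2 : ℤ) := by
    push_cast
    field_simp
  rw [h, fordDisc]
  push_cast
  rfl

lemma fordIdx_coprime (i : FordIdx) :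
    IsCoprime ((i.2.1 : ℕ) + i.2.2 * (i.1 + 1) : ℤ) ((i.1 : ℤ) + 1) := by
  obtain ⟨n, ⟨b, hb⟩, k⟩ := i
  rw [Finset.mem_filter] at hb
  have h1 : IsCoprime (b : ℤ) ((n + 1 : ℕ) : ℤ) := Nat.isCoprime_iff_coprime.mpr hb.2.symm
  push_cast at h1
  exact IsCoprime.add_mul_right_left_iff.mpr h1

lemma truncatedRegion_eq (T : ℝ) : truncatedRegion T =
    {z : ℂ | |z.re| ≤ 1 / 2 ∧ 0 < z.im ∧ z.im ≤ T} \ ⋃ i : FordIdx, fordDisc T i := by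
  rw [truncatedRegion]
  congr 1
  ext z
  simp only [Set.mem_iUnion]
  constructor
  · rintro ⟨c, hc, a, hac, hz⟩
    obtain ⟨n, rfl⟩ : ∃ n : ℕ, c = (n : ℤ) + 1 := ⟨(c - 1).toNat, by omega⟩
    obtain ⟨b, hb⟩ : ∃ b : ℕ, (b : ℤ) = a % ((n : ℤ) + 1) :=
      ⟨(a % ((n : ℤ) + 1)).toNat, Int.toNat_of_nonneg (Int.emod_nonneg _ (by omega))⟩
    have hlt : b < n + 1 := by
      have := Int.emod_lt_of_pos a (b := (n : ℤ) + 1) (by omega)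
      omega
    have ha : a = (b : ℤ) + a / ((n : ℤ) + 1) * ((n : ℤ) + 1) := by
      rw [hb, mul_comm]
      exact (Int.emod_add_mul_ediv a _).symm
    have hcop : (n + 1).Coprime b := by
      rw [ha] at hac
      have := IsCoprime.add_mul_right_left_iff.mp hac
      exact (Nat.isCoprime_iff_coprime.mp (by push_cast; exact this)).symm
    refine ⟨⟨n, ⟨b, Finset.mem_filter.mpr ⟨Finset.mem_range.mpr hlt, hcop⟩⟩, a / ((n : ℤ) + 1)⟩, ?_⟩
    rw [fordDisc_eq]
    simp only
    rw [← ha]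
    exact hz
  · rintro ⟨i, hi⟩
    rw [fordDisc_eq] at hi
    exact ⟨_, by omega, _, fordIdx_coprime i, hi⟩

lemma fordDisc_disjoint {T : ℝ} (hT : 1 ≤ T) : Pairwise (Function.onFun Disjoint (fordDisc T)) := by
  intro i j hij
  rw [Function.onFun, fordDisc_eq, fordDisc_eq]
  refine ford_disjoint hT (by omega) (by omega) ?_
  intro h
  apply hij
  have hi := fordIdx_coprime i
  have hj := fordIdx_coprime j
  obtain ⟨n, ⟨b, hb⟩, k⟩ := i
  obtain ⟨m, ⟨b', hb'⟩, k'⟩ := j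
  simp only at h hi hj
  have d1 : ((n : ℤ) + 1) ∣ (m : ℤ) + 1 :=
    hi.symm.dvd_of_dvd_mul_left (Dvd.intro_left _ h.symm)
  have d2 : ((m : ℤ) + 1) ∣ (n : ℤ) + 1 :=
    hj.symm.dvd_of_dvd_mul_left (Dvd.intro_left _ h)
  have hnm : n = m := by
    have := Int.le_of_dvd (by omega) d1
    have := Int.le_of_dvd (by omega) d2
    omega
  subst hnm
  have h' := mul_right_cancel₀ (by omega : ((n : ℤ) + 1) ≠ 0) h
  have l1 : b < n + 1 := by simpa using (Finset.mem_filter.mp hb).1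
  have l2 : b' < n + 1 := by simpa using (Finset.mem_filter.mp hb').1
  have e1 : (b : ℤ) = b' := by
    have := congrArg (· % ((n : ℤ) + 1)) h'
    simp only [Int.add_mul_emod_self_right] at this
    rwa [Int.emod_eq_of_lt (by omega) (by omega), Int.emod_eq_of_lt (by omega) (by omega)] at this
  have e2 : b = b' := by exact_mod_cast e1
  subst e2
  have e3 : k = k' := mul_right_cancel₀ (by omega : ((n : ℤ) + 1) ≠ 0) (add_left_cancel h')
  subst e3
  rfl

lemma lint_discs {T w : ℝ} (hT : 1 ≤ T) (hw : 1 < w) {Z : ℝ}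
    (hZ : HasSum (fun n : ℕ => (Nat.totient (n + 1) : ℝ) * (((n : ℝ) + 1) ^ 2) ^ (-w)) Z) :
    ∫⁻ z in {z : ℂ | |z.re| ≤ 1 / 2 ∧ 0 < z.im ∧ z.im ≤ T} ∩ ⋃ i : FordIdx, fordDisc T i,
      ENNReal.ofReal (z.im ^ (w - 2)) =
    ENNReal.ofReal (Z * (T ^ (-w) * (√π * Real.Gamma (w - 1 / 2) / Real.Gamma (w + 1)))) := by
  have hT0 : 0 < T := by linarith
  set K := √π * Real.Gamma (w - 1 / 2) / Real.Gamma (w + 1) with hK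
  have hK0 : 0 ≤ K := by
    have := Real.Gamma_pos_of_pos (by linarith : 0 < w - 1 / 2)
    have := Real.Gamma_pos_of_pos (by linarith : 0 < w + 1)
    positivity
  rw [Set.inter_iUnion, lintegral_iUnion]
  · rw [ENNReal.tsum_sigma', ← (hZ.mul_right _).tsum_eq,
      ENNReal.ofReal_tsum_of_nonneg (fun n => by positivity) (hZ.mul_right _).summable]
    congr 1
    ext n
    rw [ENNReal.tsum_prod']
    have hr : 0 < 1 / (2 * ((n : ℝ) + 1) ^ 2 * T) := by positivity
    have hrT : 2 * (1 / (2 * ((n : ℝ) + 1) ^ 2 * T)) ≤ T := by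
      rw [show 2 * (1 / (2 * ((n : ℝ) + 1) ^ 2 * T)) = 1 / (((n : ℝ) + 1) ^ 2 * T) by field_simp]
      have h1 : 1 ≤ ((n : ℝ) + 1) ^ 2 * T := by
        have : (1 : ℝ) ≤ ((n : ℝ) + 1) ^ 2 := by nlinarith [(Nat.cast_nonneg n : (0 : ℝ) ≤ n)]
        nlinarith
      exact ((div_le_one (by positivity)).mpr h1).trans hT
    have hcalc : (2 * (1 / (2 * ((n : ℝ) + 1) ^ 2 * T))) ^ w =
        (((n : ℝ) + 1) ^ 2) ^ (-w) * T ^ (-w) := by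
      rw [show 2 * (1 / (2 * ((n : ℝ) + 1) ^ 2 * T)) = (((n : ℝ) + 1) ^ 2 * T)⁻¹ by field_simp,
        ← Real.mul_rpow (by positivity) (by positivity), Real.inv_rpow (by positivity),
        Real.rpow_neg (by positivity)]
    have hone : ∀ b : {b : ℕ // b ∈ (Finset.range (n + 1)).filter (n + 1).Coprime},
        ∑' k : ℤ, ∫⁻ z in {z : ℂ | |z.re| ≤ 1 / 2 ∧ 0 < z.im ∧ z.im ≤ T} ∩
          fordDisc T ⟨n, (b, k)⟩, ENNReal.ofReal (z.im ^ (w - 2)) =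
        ENNReal.ofReal ((((n : ℝ) + 1) ^ 2) ^ (-w) * T ^ (-w) * K) := by
      intro b
      have h1 := strip_fold (p := ((b : ℕ) : ℝ) / ((n : ℝ) + 1)) hr hrT
        (fun y => ENNReal.ofReal (y ^ (w - 2)))
      rw [lint_ford hr hw, hcalc] at h1
      exact h1
    simp_rw [hone]
    rw [tsum_fintype, Finset.sum_const, Finset.card_univ, Fintype.card_coe, nsmul_eq_mul]
    change ((Nat.totient (n + 1) : ℕ) : ENNReal) * _ = _
    rw [← ENNReal.ofReal_natCast, ← ENNReal.ofReal_mul (by positivity)]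
    congr 1
    ring
  · exact fun i => (measurable_strip T).inter measurableSet_ball
  · exact fun i j hij => (fordDisc_disjoint hT hij).mono Set.inter_subset_right
      Set.inter_subset_right

lemma measurable_region (T : ℝ) : MeasurableSet (truncatedRegion T) := by
  rw [truncatedRegion_eq]
  exact (measurable_strip T).diff (MeasurableSet.iUnion fun i => measurableSet_ball)

lemma zagier {T w : ℝ} (hT : 1 ≤ T) (hw : 1 < w) :
    ((∫ z in truncatedRegion T, z.im ^ (w - 2) : ℝ) : ℂ) =
      (T : ℂ) ^ ((w : ℂ) - 1) / (w - 1) -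
          completedRiemannZeta (2 * w - 1) / completedRiemannZeta (2 * w) *
            (T : ℂ) ^ (-(w : ℂ)) / w := by
  have hT0 : 0 < T := by linarith
  obtain ⟨Z, hZ, hZc⟩ := totient_sum hw
  have hZ0 : 0 ≤ Z := hZ.nonneg fun n => by positivity
  have hG1 := Real.Gamma_pos_of_pos (by linarith : 0 < w - 1 / 2)
  have hG2 := Real.Gamma_pos_of_pos (by linarith : 0 < w + 1)
  have hU : MeasurableSet (⋃ i : FordIdx, fordDisc T i) :=
    MeasurableSet.iUnion fun i => measurableSet_ball
  obtain ⟨hi, hv⟩ := rpow_int (T := T) (a := w - 2) hT0.le (by linarith)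
  obtain ⟨hi', hv'⟩ := strip_integral hi
  have hsplit := integral_inter_add_sdiff hU hi'
  rw [← truncatedRegion_eq] at hsplit
  have hd : ∫ z in {z : ℂ | |z.re| ≤ 1 / 2 ∧ 0 < z.im ∧ z.im ≤ T} ∩ ⋃ i : FordIdx, fordDisc T i,
      z.im ^ (w - 2) = Z * (T ^ (-w) * (√π * Real.Gamma (w - 1 / 2) / Real.Gamma (w + 1))) := by
    rw [integral_eq_lintegral_of_nonneg_ae, lint_discs hT hw hZ, ENNReal.toReal_ofReal]
    · positivity
    · refine (ae_restrict_iff' ((measurable_strip T).inter hU)).mpr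
        (Eventually.of_forall fun z hz => Real.rpow_nonneg hz.1.2.1.le _)
    · exact (by fun_prop : Measurable _).aestronglyMeasurable
  rw [hd, hv', hv] at hsplit
  have hfin : ∫ z in truncatedRegion T, z.im ^ (w - 2) =
      T ^ (w - 1) / (w - 1) -
        Z * (T ^ (-w) * (√π * Real.Gamma (w - 1 / 2) / Real.Gamma (w + 1))) := by
    rw [show w - 2 + 1 = w - 1 by ring] at hsplit
    linarith
  have hcr := completed_ratio hw
  rw [hfin, mul_div_right_comm (completedRiemannZeta (2 * w - 1) / completedRiemannZeta (2 * w)),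
    hcr, ← hZc]
  generalize √π * Real.Gamma (w - 1 / 2) / Real.Gamma (w + 1) = K
  push_cast
  rw [Complex.ofReal_cpow hT0.le, Complex.ofReal_cpow hT0.le]
  push_cast
  ring

/-- Differentiated form of Zagier's truncated Rankin--Selberg formula: for real `s > 1`,
the integral of `(Im z)^{s−2}·log(Im z)` over the truncated region equals the derivative
at `s` of `w ↦ T̂^{w−1}/(w−1) − (ζ*(2w−1)/ζ*(2w))·T̂^{−w}/w`. -/
theorem integral_im_rpow_mul_log_truncatedRegion (That : ℝ) (hT : 1 ≤ That)
    (s : ℝ) (hs : 1 < s) :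
    ((∫ z in truncatedRegion That, z.im ^ (s - 2) * Real.log z.im ∂volume : ℝ) : ℂ) =
      deriv (fun w : ℂ =>
        (That : ℂ) ^ (w - 1) / (w - 1) -
          completedRiemannZeta (2 * w - 1) / completedRiemannZeta (2 * w) *
            (That : ℂ) ^ (-w) / w) (s : ℂ) := by
  have hT0 : 0 < That := by linarith
  have hTc : (That : ℂ) ≠ 0 := by exact_mod_cast hT0.ne'
  have hs0 : (s : ℂ) ≠ 0 := by exact_mod_cast (by linarith : s ≠ 0)
  have hs1 : (s : ℂ) - 1 ≠ 0 := by exact_mod_cast (by linarith : s - 1 ≠ 0)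
  have h1 : (2 * s - 1 : ℂ) ≠ 0 := by exact_mod_cast (by linarith : 2 * s - 1 ≠ 0)
  have h1' : (2 * s - 1 : ℂ) ≠ 1 := by exact_mod_cast (by linarith : 2 * s - 1 ≠ 1)
  have h2 : (2 * s : ℂ) ≠ 0 := by simpa using hs0
  have h2' : (2 * s : ℂ) ≠ 1 := by exact_mod_cast (by linarith : 2 * s ≠ 1)
  have hc : completedRiemannZeta (2 * s) ≠ 0 := by
    intro h
    have hz : riemannZeta (2 * s) ≠ 0 := riemannZeta_ne_zero_of_one_lt_re (by simp; linarith)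
    rw [riemannZeta_def_of_ne_zero h2, h] at hz
    simp at hz
  have hdiff : DifferentiableAt ℂ (fun w : ℂ =>
        (That : ℂ) ^ (w - 1) / (w - 1) -
          completedRiemannZeta (2 * w - 1) / completedRiemannZeta (2 * w) *
            (That : ℂ) ^ (-w) / w) (s : ℂ) := by
    have d1 : DifferentiableAt ℂ (fun w : ℂ => completedRiemannZeta (2 * w - 1)) (s : ℂ) :=
      DifferentiableAt.comp (s : ℂ) (differentiableAt_completedZeta h1 h1')
        (by fun_prop : DifferentiableAt ℂ (fun w : ℂ => 2 * w - 1) (s : ℂ))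
    have d2 : DifferentiableAt ℂ (fun w : ℂ => completedRiemannZeta (2 * w)) (s : ℂ) :=
      DifferentiableAt.comp (s : ℂ) (differentiableAt_completedZeta h2 h2')
        (by fun_prop : DifferentiableAt ℂ (fun w : ℂ => 2 * w) (s : ℂ))
    have d3 : DifferentiableAt ℂ (fun w : ℂ => (That : ℂ) ^ (w - 1)) (s : ℂ) :=
      DifferentiableAt.const_cpow (by fun_prop) (Or.inl hTc)
    have d4 : DifferentiableAt ℂ (fun w : ℂ => (That : ℂ) ^ (-w)) (s : ℂ) :=
      DifferentiableAt.const_cpow (by fun_prop) (Or.inl hTc)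
    exact (d3.div (by fun_prop) hs1).sub (((d1.div d2 hc).mul d4).div (by fun_prop) hs0)
  have hA := hdiff.hasDerivAt.comp_ofReal
  have hB := (deriv_under hT0.le hs (R := truncatedRegion That) Set.sdiff_subset
    (measurable_region That)).ofReal_comp
  refine hB.unique (hA.congr_of_eventuallyEq ?_)
  filter_upwards [lt_mem_nhds hs] with w hw
  exact zagier hT hw
end
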